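/- Fix multisets μ, ν, π of natural numbers all of whose elements are at least 2, and assume (μ.sum − μ.card) + (ν.sum − ν.card) = (π.sum − π.card) + 1. Then the following count does not depend on n: for all natural numbers n₁, n₂, all fixed-point-free involutions F₁, F₂ of Fin (2n₁) with cycleType (F₁ * F₂) = π + π, and all fixed-point-free involutions G₁, G₂ of Fin (2n₂) with cycleType (G₁ * G₂) = π + π, the number of fixed-point-free involutions F₃ of Fin (2n₁) with cycleType (F₁ * F₃) = μ + μ and cycleType (F₂ * F₃) = ν + ν equals the number of fixed-point-free involutions G₃ of Fin (2n₂) with cycleType (G₁ * G₃) = μ + μ and cycleType (G₂ * G₃) = ν + ν. -/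

import Mathlib

/-- A fixed-point-free involution, encoding a perfect matching. -/
def IsPerfectMatching {α : Type*} (F : Equiv.Perm α) : Prop :=
  F * F = 1 ∧ ∀ x, F x ≠ x

/-- functions invariant under a permutation -/
def fixSub {α : Type*} (σ : Equiv.Perm α) : Submodule ℚ (α → ℚ) where
  carrier := {f | ∀ x, f (σ x) = f x}
  add_mem' := by
    intro a b ha hb x
    simp only [Set.mem_ofPred_eq] at ha hb
    simp [ha x, hb x]
  zero_mem' := by intro x; simp
  smul_mem' := by
    intro c a ha x
    simp only [Set.mem_ofPred_eq] at ha
    simp [ha x]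

theorem mem_fixSub {α : Type*} (σ : Equiv.Perm α) (f : α → ℚ) :
    f ∈ fixSub σ ↔ ∀ x, f (σ x) = f x := Iff.rfl

theorem fixSub_sameCycle {α : Type*} (σ : Equiv.Perm α) (f : α → ℚ) (hf : f ∈ fixSub σ)
    {x y : α} (h : σ.SameCycle x y) : f x = f y := by
  obtain ⟨k, rfl⟩ := h
  induction k using Int.induction_on with
  | zero => simp
  | succ n ih => rw [ih, add_comm, zpow_add, zpow_one, Equiv.Perm.mul_apply, hf]
  | pred n ih =>
    rw [ih, ← hf ((σ ^ (-(n:ℤ) - 1)) x), ← Equiv.Perm.mul_apply, ← zpow_one_add]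
    congr 3; ring

theorem finrank_fixSub {α : Type*} [Fintype α] [DecidableEq α] (σ : Equiv.Perm α) :
    Module.finrank ℚ (fixSub σ) + σ.cycleType.sum = Fintype.card α + σ.cycleType.card := by
  classical
  let q : α → (σ.cycleFactorsFinset ⊕ {x // σ x = x}) := fun x =>
    if h : σ x = x then Sum.inr ⟨x, h⟩
    else Sum.inl ⟨σ.cycleOf x, by
      rw [Equiv.Perm.cycleOf_mem_cycleFactorsFinset_iff]; simpa using h⟩
  have hq : Function.Surjective q := by
    rintro (⟨c, hc⟩ | ⟨x, hx⟩)
    · obtain ⟨x, hx⟩ := (Equiv.Perm.mem_cycleFactorsFinset_iff.1 hc).1.nonempty_support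
      refine ⟨x, ?_⟩
      have h1 := Equiv.Perm.cycle_is_cycleOf hx hc
      have h2 : σ x ≠ x := by
        have := Equiv.Perm.mem_cycleFactorsFinset_support_le hc hx
        simpa using this
      simp [q, h2, h1]
    · exact ⟨x, by simp [q, hx]⟩
  have hsame : ∀ x y, q x = q y → σ.SameCycle x y := by
    intro x y h
    by_cases hx : σ x = x <;> by_cases hy : σ y = y <;> simp [q, hx, hy] at h
    · rw [h]
    · rw [Equiv.Perm.sameCycle_iff_cycleOf_eq_of_mem_support] <;> simp [hx, hy, h]
  have hinv : ∀ x, q (σ x) = q x := by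
    intro x
    by_cases hx : σ x = x
    · rw [hx]
    · have : ¬ σ (σ x) = σ x := by simpa using hx
      simp only [q, hx, this, dif_neg, not_false_eq_true]
      congr 2
      exact (Equiv.Perm.SameCycle.cycleOf_eq (Equiv.Perm.sameCycle_apply_left.2 (Equiv.Perm.SameCycle.refl _ _)))
  have hr : LinearMap.range (LinearMap.funLeft ℚ ℚ q) = fixSub σ := by
    ext f
    constructor
    · rintro ⟨g, rfl⟩ x
      simp [LinearMap.funLeft_apply, hinv]
    · intro hf
      refine ⟨fun z => f (Function.surjInv hq z), ?_⟩
      ext x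
      simp only [LinearMap.funLeft_apply]
      exact fixSub_sameCycle σ f hf (hsame _ _ (Function.surjInv_eq hq _))
  have h1 : Module.finrank ℚ (fixSub σ) = σ.cycleType.card + Fintype.card {x // σ x = x} := by
    rw [← hr, LinearMap.finrank_range_of_inj (LinearMap.funLeft_injective_of_surjective _ _ _ hq)]
    simp [Equiv.Perm.cycleType_def]
  have h2 : Fintype.card {x // σ x = x} + σ.support.card = Fintype.card α := by
    rw [Fintype.card_subtype, ← Finset.card_compl_add_card σ.support]
    congr 2
    ext; simp
  rw [Equiv.Perm.sum_cycleType]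
  omega

theorem fix_tri {α : Type*} [Fintype α] (σ τ : Equiv.Perm α) :
    Module.finrank ℚ (fixSub σ) + Module.finrank ℚ (fixSub τ) ≤
      Fintype.card α + Module.finrank ℚ (fixSub (σ * τ)) := by
  have h := Submodule.finrank_sup_add_finrank_inf_eq (fixSub σ) (fixSub τ)
  have h1 : Module.finrank ℚ ↥(fixSub σ ⊔ fixSub τ) ≤ Fintype.card α := by
    simpa using Submodule.finrank_le (fixSub σ ⊔ fixSub τ)
  have h2 : Module.finrank ℚ ↥(fixSub σ ⊓ fixSub τ) ≤ Module.finrank ℚ (fixSub (σ * τ)) := by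
    apply Submodule.finrank_mono
    rintro f ⟨hf, hg⟩ x
    rw [Equiv.Perm.mul_apply, hf, hg]
  omega

theorem fix_inv {α : Type*} (σ : Equiv.Perm α) : fixSub σ⁻¹ = fixSub σ := by
  ext f
  constructor
  · intro h x
    have := h (σ x)
    simpa using this.symm
  · intro h x
    have := h (σ⁻¹ x)
    simpa using this.symm

theorem fix_split {α : Type*} [Fintype α] [DecidableEq α] (τ : Equiv.Perm α) (b x : α)
    (hb : τ b = x) (hbx : b ≠ x) :
    Module.finrank ℚ (fixSub τ) + 1 ≤ Module.finrank ℚ (fixSub (τ * Equiv.swap b x)) := by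
  have hlt : fixSub τ < fixSub (τ * Equiv.swap b x) := by
    rw [SetLike.lt_iff_le_and_exists]
    refine ⟨?_, Pi.single x 1, ?_, ?_⟩
    · intro f hf z
      have := hf b
      rw [hb] at this
      rw [Equiv.Perm.mul_apply, hf]
      rcases eq_or_ne z b with rfl | h1
      · simp [this]
      rcases eq_or_ne z x with rfl | h2
      · simp [this]
      rw [Equiv.swap_apply_of_ne_of_ne h1 h2]
    · intro z
      have hx : (τ * Equiv.swap b x) x = x := by simp [hb]
      rcases eq_or_ne z x with rfl | h2
      · rw [hx]
      · have : (τ * Equiv.swap b x) z ≠ x := by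
          intro h; apply h2; apply (τ * Equiv.swap b x).injective; rw [h, hx]
        rw [Pi.single_eq_of_ne h2, Pi.single_eq_of_ne this]
    · intro h
      have := h b
      rw [hb, Pi.single_eq_same, Pi.single_eq_of_ne hbx] at this
      norm_num at this
  exact Submodule.finrank_lt_finrank_of_lt hlt

theorem IsPerfectMatching.app {α : Type*} {F : Equiv.Perm α} (h : IsPerfectMatching F) (x : α) :
    F (F x) = x := by
  have := congrArg (fun g => g x) h.1
  simpa using this

/-- switching the third matching so that it contains the edge `x y` -/
theorem fix_switch {α : Type*} [Fintype α] [DecidableEq α] (F H : Equiv.Perm α)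
    (hF : IsPerfectMatching F) (hH : IsPerfectMatching H) (x y : α) (hxy : F x = y)
    (hne : H x ≠ y) :
    Module.finrank ℚ (fixSub (F * H)) + 2 ≤
      Module.finrank ℚ (fixSub (F * (H * (Equiv.swap (H y) x * Equiv.swap (H x) y)))) := by
  have hyx : F y = x := by rw [← hxy, hF.app]
  have h1 : H y ≠ x := by intro h; apply hne; rw [← h, hH.app]
  have a1 := fix_split (F * H) (H y) x (by simp [hH.app, hyx]) h1
  have hx : x ≠ y := by rw [← hxy]; exact (hF.2 x).symm
  have a2 := fix_split (F * H * Equiv.swap (H y) x) (H x) y (by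
    rw [Equiv.Perm.mul_apply, Equiv.swap_apply_of_ne_of_ne]
    · simp [hH.app, hxy]
    · intro h; exact hx (H.injective h)
    · exact hH.2 x) hne
  have e : F * H * Equiv.swap (H y) x * Equiv.swap (H x) y =
      F * (H * (Equiv.swap (H y) x * Equiv.swap (H x) y)) := by group
  rw [e] at a2
  omega

theorem agree_of_eq {α : Type*} [Fintype α] [DecidableEq α] (μ ν π : Multiset ℕ)
    (hμ : ∀ x ∈ μ, 2 ≤ x) (hν : ∀ x ∈ ν, 2 ≤ x) (hπ : ∀ x ∈ π, 2 ≤ x)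
    (heq : (μ.sum - μ.card) + (ν.sum - ν.card) = (π.sum - π.card) + 1)
    (F₁ F₂ H : Equiv.Perm α) (h₁ : IsPerfectMatching F₁) (h₂ : IsPerfectMatching F₂)
    (hH : IsPerfectMatching H) (hp : (F₁ * F₂).cycleType = π + π)
    (hm : (F₁ * H).cycleType = μ + μ) (hn : (F₂ * H).cycleType = ν + ν)
    (x : α) (hx : F₁ x = F₂ x) : H x = F₁ x := by
  by_contra hne
  have b1 := fix_switch F₁ H h₁ hH x (F₁ x) rfl hne
  have b2 := fix_switch F₂ H h₂ hH x (F₁ x) hx.symm hne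
  set K := H * (Equiv.swap (H (F₁ x)) x * Equiv.swap (H x) (F₁ x))
  have t := fix_tri (F₁ * K) (F₂ * K)⁻¹
  rw [fix_inv] at t
  have e : F₁ * K * (F₂ * K)⁻¹ = F₁ * F₂ := by
    have : F₂⁻¹ = F₂ := inv_eq_of_mul_eq_one_left h₂.1
    rw [mul_inv_rev, this]; group
  rw [e] at t
  have c1 := finrank_fixSub (F₁ * F₂)
  have c2 := finrank_fixSub (F₁ * H)
  have c3 := finrank_fixSub (F₂ * H)
  rw [hp] at c1; rw [hm] at c2; rw [hn] at c3
  have key : ∀ m : Multiset ℕ, (∀ x ∈ m, 2 ≤ x) → m.card ≤ m.sum := by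
    intro m hm
    have := Multiset.card_nsmul_le_sum (s := m) (a := 1) (fun x hx => by have := hm x hx; omega)
    simpa using this
  have k1 := key μ hμ
  have k2 := key ν hν
  have k3 := key π hπ
  simp only [Multiset.sum_add, Multiset.card_add] at c1 c2 c3
  omega

theorem cycleType_permCongr' {α β : Type*} [Fintype α] [DecidableEq α] [Fintype β] [DecidableEq β]
    (e : α ≃ β) (σ : Equiv.Perm α) : (e.permCongr σ).cycleType = σ.cycleType := by
  rw [← Equiv.Perm.cycleType_extendDomain (p := fun _ : β => True)
    (e.trans (Equiv.subtypeUnivEquiv (fun _ => trivial)).symm) (g := σ)]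
  congr 1

theorem conj_of_cycleType {α β : Type*} [Fintype α] [DecidableEq α] [Fintype β] [DecidableEq β]
    (hc : Fintype.card α = Fintype.card β) (σ : Equiv.Perm α) (τ : Equiv.Perm β)
    (h : σ.cycleType = τ.cycleType) : ∃ e : α ≃ β, ∀ x, e (σ x) = τ (e x) := by
  let e0 := Fintype.equivOfCardEq hc
  have h1 : (e0.permCongr σ).cycleType = τ.cycleType := by rw [cycleType_permCongr', h]
  obtain ⟨c, hc⟩ := isConj_iff.1 (Equiv.Perm.isConj_of_cycleType_eq h1)
  refine ⟨e0.trans c, fun x => ?_⟩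
  rw [← hc]
  simp [Equiv.permCongr_apply]

theorem pm_conj_zpow {α : Type*} (F₁ F₂ : Equiv.Perm α) (h₁ : IsPerfectMatching F₁)
    (h₂ : IsPerfectMatching F₂) (k : ℤ) :
    F₁ * (F₁ * F₂) ^ k = (F₁ * F₂) ^ (-k) * F₁ := by
  have i1 : F₁⁻¹ = F₁ := inv_eq_of_mul_eq_one_left h₁.1
  have i2 : F₂⁻¹ = F₂ := inv_eq_of_mul_eq_one_left h₂.1
  have h := conj_zpow (i := k) (a := F₁) (b := F₁ * F₂)
  have e : F₁ * (F₁ * F₂) * F₁⁻¹ = (F₁ * F₂)⁻¹ := by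
    rw [mul_inv_rev, i1, i2, ← mul_assoc, h₁.1, one_mul]
  rw [e] at h
  rw [zpow_neg, ← inv_zpow, h]; group

theorem not_sameCycle {α : Type*} (F₁ F₂ : Equiv.Perm α) (h₁ : IsPerfectMatching F₁)
    (h₂ : IsPerfectMatching F₂) (x : α) : ¬ (F₁ * F₂).SameCycle x (F₁ x) := by
  rintro ⟨k, hk⟩
  obtain ⟨j, rfl | rfl⟩ := Int.even_or_odd' k
  · apply h₁.2 (((F₁ * F₂) ^ j) x)
    rw [← Equiv.Perm.mul_apply, pm_conj_zpow F₁ F₂ h₁ h₂, Equiv.Perm.mul_apply, ← hk,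
      ← Equiv.Perm.mul_apply, ← zpow_add]
    congr 2; ring
  · apply h₂.2 (((F₁ * F₂) ^ j) x)
    apply F₁.injective
    have : F₁ (((F₁ * F₂) ^ j) x) = ((F₁ * F₂) ^ (j + 1)) x := by
      rw [← Equiv.Perm.mul_apply, pm_conj_zpow F₁ F₂ h₁ h₂, Equiv.Perm.mul_apply, ← hk,
        ← Equiv.Perm.mul_apply, ← zpow_add]
      congr 2; ring
    rw [this, add_comm, zpow_add, zpow_one]
    rfl

/-- a set of cycles of `F₁ F₂` meeting every pair of mirror cycles once -/
theorem exists_half {α : Type*} [Fintype α] [DecidableEq α] (π : Multiset ℕ)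
    (F₁ F₂ : Equiv.Perm α) (h₁ : IsPerfectMatching F₁)
    (h₂ : IsPerfectMatching F₂) (hp : (F₁ * F₂).cycleType = π + π) :
    ∃ A : Finset α, (∀ x, F₁ x ∈ A ↔ x ∉ A) ∧ 2 * A.card = Fintype.card α ∧
      ∃ hA : ∀ x, (F₁ * F₂) x ∈ A ↔ x ∈ A,
        ((F₁ * F₂).subtypePerm hA).cycleType = π := by
  classical
  set σ := F₁ * F₂ with hσ
  have hcF : ∀ x, F₁ (σ x) = σ⁻¹ (F₁ x) := by
    intro x
    have := pm_conj_zpow F₁ F₂ h₁ h₂ 1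
    rw [zpow_one, zpow_neg, zpow_one] at this
    exact congrArg (fun g => g x) this
  let Q := Quotient (Equiv.Perm.SameCycle.setoid σ)
  let eQ := Fintype.equivFin Q
  let c : α → Fin (Fintype.card Q) := fun x => eQ (Quotient.mk _ x)
  have hc : ∀ x y, c x = c y ↔ σ.SameCycle x y := by
    intro x y
    simp only [c, EmbeddingLike.apply_eq_iff_eq]
    exact Quotient.eq
  let A : Finset α := Finset.univ.filter (fun x => c x < c (F₁ x))
  have hAm : ∀ x, x ∈ A ↔ c x < c (F₁ x) := by intro x; simp [A]
  have hF : ∀ x, F₁ x ∈ A ↔ x ∉ A := by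
    intro x
    rw [hAm, hAm, h₁.app]
    have : c x ≠ c (F₁ x) := by
      rw [Ne, hc]; exact not_sameCycle F₁ F₂ h₁ h₂ x
    constructor
    · intro h; exact not_lt.2 h.le
    · intro h; exact lt_of_le_of_ne (not_lt.1 h) this.symm
  have hA : ∀ x, σ x ∈ A ↔ x ∈ A := by
    intro x
    rw [hAm, hAm]
    have a1 : c (σ x) = c x := by
      rw [hc]; exact Equiv.Perm.sameCycle_apply_left.2 (Equiv.Perm.SameCycle.refl _ _)
    have a2 : c (F₁ (σ x)) = c (F₁ x) := by
      rw [hcF, hc]; exact Equiv.Perm.sameCycle_inv.1 <| Equiv.Perm.sameCycle_apply_left.2 (Equiv.Perm.SameCycle.refl _ _)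
    rw [a1, a2]
  refine ⟨A, hF, ?_, hA, ?_⟩
  · have : Aᶜ = A.map F₁.toEmbedding := by
      ext x
      simp only [Finset.mem_compl, Finset.mem_map, Equiv.coe_toEmbedding]
      constructor
      · intro h; exact ⟨F₁ x, (hF x).2 h, h₁.app x⟩
      · rintro ⟨y, hy, rfl⟩ h; exact (hF y).1 h hy
    have h2 := Finset.card_compl_add_card A
    rw [this, Finset.card_map] at h2
    omega
  · set ρ := σ.subtypePerm hA with hρ
    let R : Equiv.Perm α := Equiv.Perm.ofSubtype ρ
    have R1 : ∀ x, x ∈ A → R x = σ x := fun x hx =>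
      Equiv.Perm.ofSubtype_subtypePerm_of_mem hA hx
    have R2 : ∀ x, x ∉ A → R x = x := fun x hx =>
      Equiv.Perm.ofSubtype_subtypePerm_of_not_mem hA hx
    let T : Equiv.Perm α := F₁ * R⁻¹ * F₁⁻¹
    have i1 : F₁⁻¹ = F₁ := inv_eq_of_mul_eq_one_left h₁.1
    have T1 : ∀ x, x ∈ A → T x = x := by
      intro x hx
      have : F₁ x ∉ A := fun h => (hF x).1 h hx
      have h3 : R⁻¹ (F₁ x) = F₁ x := by
        rw [Equiv.Perm.inv_eq_iff_eq, R2 _ this]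
      simp only [T, Equiv.Perm.mul_apply, i1, h3, h₁.app]
    have T2 : ∀ x, x ∉ A → T x = σ x := by
      intro x hx
      have : F₁ x ∈ A := (hF x).2 hx
      have h3 : R⁻¹ (F₁ x) = F₁ (σ x) := by
        rw [Equiv.Perm.inv_eq_iff_eq, R1 _ ((hF _).2 (fun h => hx ((hA x).1 h))), hcF]
        simp
      simp only [T, Equiv.Perm.mul_apply, i1, h3, h₁.app]
    have hd : Equiv.Perm.Disjoint R T := by
      intro x
      by_cases hx : x ∈ A
      · exact Or.inr (T1 x hx)
      · exact Or.inl (R2 x hx)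
    have hRT : σ = R * T := by
      apply Equiv.ext
      intro x
      by_cases hx : x ∈ A
      · rw [Equiv.Perm.mul_apply R T, T1 x hx, R1 x hx]
      · rw [Equiv.Perm.mul_apply R T, T2 x hx, R2 _ (fun h => hx ((hA x).1 h))]
    have hR : R.cycleType = ρ.cycleType := Equiv.Perm.cycleType_ofSubtype
    have hT : T.cycleType = ρ.cycleType := by
      rw [Equiv.Perm.cycleType_conj, Equiv.Perm.cycleType_inv, hR]
    rw [hRT, hd.cycleType_mul, hR, hT] at hp
    ext a
    have := congrArg (Multiset.count a) hp
    simp only [Multiset.count_add] at this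
    omega

theorem exists_conj {α β : Type*} [Fintype α] [DecidableEq α] [Fintype β] [DecidableEq β]
    (hcard : Fintype.card α = Fintype.card β) (π : Multiset ℕ)
    (F₁ F₂ : Equiv.Perm α) (G₁ G₂ : Equiv.Perm β) (h₁ : IsPerfectMatching F₁)
    (h₂ : IsPerfectMatching F₂) (k₁ : IsPerfectMatching G₁) (k₂ : IsPerfectMatching G₂)
    (hp : (F₁ * F₂).cycleType = π + π) (kp : (G₁ * G₂).cycleType = π + π) :
    ∃ e : α ≃ β, (∀ x, e (F₁ x) = G₁ (e x)) ∧ ∀ x, e (F₂ x) = G₂ (e x) := by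
  obtain ⟨A, hF, cA, hA, ctA⟩ := exists_half π F₁ F₂ h₁ h₂ hp
  obtain ⟨B, hG, cB, hB, ctB⟩ := exists_half π G₁ G₂ k₁ k₂ kp
  obtain ⟨e, he⟩ := conj_of_cycleType (α := A) (β := B) (by simp; omega) _ _ (ctA.trans ctB.symm)
  let f : α → β := fun x =>
    if h : x ∈ A then (e ⟨x, h⟩ : β) else G₁ (e ⟨F₁ x, (hF x).2 h⟩ : β)
  have f1 : ∀ x (h : x ∈ A), f x = e ⟨x, h⟩ := fun x h => by simp [f, h]
  have f2 : ∀ x (h : x ∉ A), f x = G₁ (e ⟨F₁ x, (hF x).2 h⟩ : β) := fun x h => by simp [f, h]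
  have fm : ∀ x, f x ∈ B ↔ x ∈ A := by
    intro x
    by_cases h : x ∈ A
    · rw [f1 x h]; simp [h]
    · rw [f2 x h, hG]; simp [h]
  have finj : Function.Injective f := by
    intro x y hxy
    have hm : x ∈ A ↔ y ∈ A := by rw [← fm, ← fm, hxy]
    by_cases h : x ∈ A
    · rw [f1 x h, f1 y (hm.1 h)] at hxy
      have := e.injective (Subtype.ext hxy)
      simpa using this
    · rw [f2 x h, f2 y (fun h' => h (hm.2 h'))] at hxy
      have := e.injective (Subtype.ext (G₁.injective hxy))
      simpa using this
  have fbij : Function.Bijective f := (Fintype.bijective_iff_injective_and_card f).2 ⟨finj, hcard⟩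
  have fF : ∀ x, f (F₁ x) = G₁ (f x) := by
    intro x
    by_cases h : x ∈ A
    · rw [f2 (F₁ x) (fun h' => (hF x).1 h' h), f1 x h]
      simp [h₁.app]
    · rw [f1 (F₁ x) ((hF x).2 h), f2 x h, k₁.app]
  have fσA : ∀ x, x ∈ A → f ((F₁ * F₂) x) = (G₁ * G₂) (f x) := by
    intro x h
    rw [f1 x h, f1 _ ((hA x).2 h)]
    have := congrArg Subtype.val (he ⟨x, h⟩)
    simpa using this
  have fF2A : ∀ x, x ∈ A → f (F₂ x) = G₂ (f x) := by
    intro x h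
    have := fσA x h
    rw [Equiv.Perm.mul_apply, Equiv.Perm.mul_apply, fF] at this
    exact G₁.injective this
  refine ⟨Equiv.ofBijective f fbij, fF, ?_⟩
  intro x
  change f (F₂ x) = G₂ (f x)
  by_cases h : x ∈ A
  · exact fF2A x h
  · have h2 : F₂ x ∈ A := by
      by_contra h'
      have := (hF _).2 h'
      rw [← Equiv.Perm.mul_apply, hA] at this
      exact h this
    have := fF2A _ h2
    rw [h₂.app] at this
    rw [this, k₂.app]

theorem count_congr {α β : Type*} [Fintype α] [DecidableEq α] [Fintype β] [DecidableEq β]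
    (μ ν : Multiset ℕ) (F₁ F₂ : Equiv.Perm α) (G₁ G₂ : Equiv.Perm β) (e : α ≃ β)
    (e1 : ∀ x, e (F₁ x) = G₁ (e x)) (e2 : ∀ x, e (F₂ x) = G₂ (e x)) :
    Nat.card {F₃ : Equiv.Perm α // IsPerfectMatching F₃ ∧ (F₁ * F₃).cycleType = μ + μ ∧
          (F₂ * F₃).cycleType = ν + ν}
        = Nat.card {G₃ : Equiv.Perm β // IsPerfectMatching G₃ ∧ (G₁ * G₃).cycleType = μ + μ ∧
            (G₂ * G₃).cycleType = ν + ν} := by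
  refine Nat.card_congr (e.permCongr.subtypeEquiv ?_)
  intro H
  have c1 : G₁ * e.permCongr H = e.permCongr (F₁ * H) := by
    ext x; simp [Equiv.permCongr_apply, e1]
  have c2 : G₂ * e.permCongr H = e.permCongr (F₂ * H) := by
    ext x; simp [Equiv.permCongr_apply, e2]
  rw [c1, c2, cycleType_permCongr', cycleType_permCongr']
  refine and_congr ?_ Iff.rfl
  constructor
  · intro h
    refine ⟨?_, ?_⟩
    · ext x; simp [Equiv.permCongr_apply, h.app]
    · intro x hx
      apply h.2 (e.symm x)
      apply e.injective
      simpa [Equiv.permCongr_apply] using hx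
  · intro h
    refine ⟨?_, ?_⟩
    · ext x
      have := h.app (e x)
      simpa [Equiv.permCongr_apply] using this
    · intro x hx
      apply h.2 (e x)
      simp [Equiv.permCongr_apply, hx]

theorem restrict_pm {α : Type*} {p : α → Prop} {F : Equiv.Perm α} (h : IsPerfectMatching F)
    (hF : ∀ x, p (F x) ↔ p x) : IsPerfectMatching (F.subtypePerm hF) := by
  refine ⟨?_, ?_⟩
  · apply Equiv.ext
    intro x
    exact Subtype.ext (h.app x)
  · intro x hx
    exact h.2 x (by simpa using congrArg Subtype.val hx)

theorem count_restrict {α : Type*} [Fintype α] [DecidableEq α] (μ ν : Multiset ℕ)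
    (F₁ F₂ : Equiv.Perm α) (h₁ : IsPerfectMatching F₁) (h₂ : IsPerfectMatching F₂)
    (p : α → Prop) [DecidablePred p] (hpF : ∀ x, ¬ p x → F₁ x = F₂ x)
    (q₁ : ∀ x, p (F₁ x) ↔ p x) (q₂ : ∀ x, p (F₂ x) ↔ p x)
    (hag : ∀ H : Equiv.Perm α, IsPerfectMatching H → (F₁ * H).cycleType = μ + μ →
      (F₂ * H).cycleType = ν + ν → ∀ x, ¬ p x → H x = F₁ x) :
    Nat.card {F₃ : Equiv.Perm α // IsPerfectMatching F₃ ∧ (F₁ * F₃).cycleType = μ + μ ∧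
          (F₂ * F₃).cycleType = ν + ν}
      = Nat.card {G₃ : Equiv.Perm (Subtype p) // IsPerfectMatching G₃ ∧
          (F₁.subtypePerm q₁ * G₃).cycleType = μ + μ ∧
          (F₂.subtypePerm q₂ * G₃).cycleType = ν + ν} := by
  symm
  let K : Equiv.Perm (Subtype p) → Equiv.Perm α := fun g =>
    F₁ * Equiv.Perm.ofSubtype (F₁.subtypePerm q₁ * g)
  have K1 : ∀ g x (h : p x), K g x = g ⟨x, h⟩ := by
    intro g x h
    simp only [K, Equiv.Perm.mul_apply]
    rw [Equiv.Perm.ofSubtype_apply_of_mem _ h]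
    simp [h₁.app]
  have K2 : ∀ g x, ¬ p x → K g x = F₁ x := by
    intro g x h
    simp only [K, Equiv.Perm.mul_apply]
    rw [Equiv.Perm.ofSubtype_apply_of_not_mem _ h]
  have Kc1 : ∀ g, F₁ * K g = Equiv.Perm.ofSubtype (F₁.subtypePerm q₁ * g) := by
    intro g; simp only [K]; rw [← mul_assoc, h₁.1, one_mul]
  have Kc2 : ∀ g, F₂ * K g = Equiv.Perm.ofSubtype (F₂.subtypePerm q₂ * g) := by
    intro g; ext x
    by_cases h : p x
    · rw [Equiv.Perm.ofSubtype_apply_of_mem _ h, Equiv.Perm.mul_apply, K1 g x h]; simp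
    · rw [Equiv.Perm.ofSubtype_apply_of_not_mem _ h, Equiv.Perm.mul_apply, K2 g x h, hpF x h,
        h₂.app]
  have Kpm : ∀ g, IsPerfectMatching g → IsPerfectMatching (K g) := by
    intro g hg
    refine ⟨?_, ?_⟩
    · ext x
      by_cases h : p x
      · rw [Equiv.Perm.mul_apply, K1 g x h, K1 g _ (g ⟨x, h⟩).2]
        simp [hg.app]
      · rw [Equiv.Perm.mul_apply, K2 g x h, K2 g _ (fun h' => h ((q₁ x).1 h')), h₁.app]; rfl
    · intro x
      by_cases h : p x
      · rw [K1 g x h]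
        intro h'
        exact hg.2 ⟨x, h⟩ (Subtype.ext h')
      · rw [K2 g x h]; exact h₁.2 x
  refine Nat.card_congr (Equiv.ofBijective (fun g => ⟨K g.1, Kpm _ g.2.1, ?_, ?_⟩) ⟨?_, ?_⟩)
  · rw [Kc1, Equiv.Perm.cycleType_ofSubtype]; exact g.2.2.1
  · rw [Kc2, Equiv.Perm.cycleType_ofSubtype]; exact g.2.2.2
  · intro g g' hgg
    have h := congrArg Subtype.val hgg
    simp only at h
    apply Subtype.ext
    ext x
    rw [← K1 g.1 x.1 x.2, ← K1 g'.1 x.1 x.2, h]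
  · rintro ⟨H, hH, hm, hn⟩
    have ha := hag H hH hm hn
    have qH0 : ∀ x, ¬ p x → ¬ p (H x) := by
      intro x h; rw [ha x h, q₁]; exact h
    have qH : ∀ x, p (H x) ↔ p x := by
      intro x
      constructor
      · intro h; by_contra h'; exact qH0 x h' h
      · intro h; by_contra h'
        have := qH0 _ h'
        rw [hH.app] at this; exact this h
    have hK : K (H.subtypePerm qH) = H := by
      ext x
      by_cases h : p x
      · rw [K1 _ x h]; simp
      · rw [K2 _ x h, ha x h]
    refine ⟨⟨H.subtypePerm qH, restrict_pm hH qH, ?_, ?_⟩, ?_⟩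
    · rw [← Equiv.Perm.cycleType_ofSubtype, ← Kc1, hK]; exact hm
    · rw [← Equiv.Perm.cycleType_ofSubtype, ← Kc2, hK]; exact hn
    · exact Subtype.ext hK

theorem restrict_data {α : Type*} [Fintype α] [DecidableEq α] (π : Multiset ℕ)
    (F₁ F₂ : Equiv.Perm α) (h₁ : IsPerfectMatching F₁) (h₂ : IsPerfectMatching F₂)
    (hp : (F₁ * F₂).cycleType = π + π) :
    ∃ (q₁ : ∀ x, F₁ (F₁ x) ≠ F₂ (F₁ x) ↔ F₁ x ≠ F₂ x)
      (q₂ : ∀ x, F₁ (F₂ x) ≠ F₂ (F₂ x) ↔ F₁ x ≠ F₂ x),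
      (F₁.subtypePerm (p := fun x => F₁ x ≠ F₂ x) q₁ *
        F₂.subtypePerm (p := fun x => F₁ x ≠ F₂ x) q₂).cycleType = π + π ∧
      Fintype.card {x // F₁ x ≠ F₂ x} = (π + π).sum := by
  have q₁ : ∀ x, F₁ (F₁ x) ≠ F₂ (F₁ x) ↔ F₁ x ≠ F₂ x := by
    intro x
    rw [h₁.app, not_iff_not]
    constructor
    · intro h
      have := congrArg F₂ h
      rw [h₂.app] at this; exact this.symm
    · intro h; rw [h, h₂.app]
  have q₂ : ∀ x, F₁ (F₂ x) ≠ F₂ (F₂ x) ↔ F₁ x ≠ F₂ x := by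
    intro x
    rw [h₂.app, not_iff_not]
    constructor
    · intro h
      have := congrArg F₁ h
      rw [h₁.app] at this; exact this.symm
    · intro h; rw [← h, h₁.app]
  refine ⟨q₁, q₂, ?_, ?_⟩
  · rw [← hp, ← Equiv.Perm.cycleType_ofSubtype]
    congr 1
    ext x
    by_cases h : F₁ x = F₂ x
    · rw [Equiv.Perm.ofSubtype_apply_of_not_mem (p := fun x => F₁ x ≠ F₂ x) _ (not_not.2 h),
        Equiv.Perm.mul_apply, ← h,
        h₁.app]
    · rw [Equiv.Perm.ofSubtype_apply_of_mem (p := fun x => F₁ x ≠ F₂ x) _ h]; rfl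
  · rw [← hp, Equiv.Perm.sum_cycleType, Fintype.card_subtype]
    congr 1
    ext x
    simp only [Finset.mem_filter, Finset.mem_univ, true_and, Equiv.Perm.mem_support,
      Equiv.Perm.mul_apply, not_iff_not, ne_eq]
    constructor
    · intro h; rw [← h, h₁.app]
    · intro h
      have := congrArg F₁ h
      rw [h₁.app] at this; exact this.symm

/-- In the case `(|μ|-ℓ(μ)) + (|ν|-ℓ(ν)) = (|π|-ℓ(π)) + 1`, the matching count
(i.e. the renormalized structure constant of the Hecke algebra of `(S_{2n}, H_n)`)
does not depend on `n`. -/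
theorem hecke_count_independent_of_n
    (μ ν π : Multiset ℕ)
    (hμ : ∀ x ∈ μ, 2 ≤ x) (hν : ∀ x ∈ ν, 2 ≤ x) (hπ : ∀ x ∈ π, 2 ≤ x)
    (heq : (μ.sum - μ.card) + (ν.sum - ν.card) = (π.sum - π.card) + 1) :
    ∀ (n₁ n₂ : ℕ)
      (F₁ F₂ : Equiv.Perm (Fin (2 * n₁))) (G₁ G₂ : Equiv.Perm (Fin (2 * n₂))),
      IsPerfectMatching F₁ → IsPerfectMatching F₂ →
      (F₁ * F₂).cycleType = π + π →
      IsPerfectMatching G₁ → IsPerfectMatching G₂ →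
      (G₁ * G₂).cycleType = π + π →
      Nat.card {F₃ : Equiv.Perm (Fin (2 * n₁)) //
          IsPerfectMatching F₃ ∧ (F₁ * F₃).cycleType = μ + μ ∧
          (F₂ * F₃).cycleType = ν + ν}
        = Nat.card {G₃ : Equiv.Perm (Fin (2 * n₂)) //
            IsPerfectMatching G₃ ∧ (G₁ * G₃).cycleType = μ + μ ∧
            (G₂ * G₃).cycleType = ν + ν} := by
  intro n₁ n₂ F₁ F₂ G₁ G₂ h₁ h₂ hp k₁ k₂ kp
  obtain ⟨q₁, q₂, hc, hcard⟩ := restrict_data π F₁ F₂ h₁ h₂ hp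
  obtain ⟨r₁, r₂, kc, kcard⟩ := restrict_data π G₁ G₂ k₁ k₂ kp
  rw [count_restrict μ ν F₁ F₂ h₁ h₂ (fun x => F₁ x ≠ F₂ x) (fun x h => not_not.1 h) q₁ q₂
      (fun H hH hm hn x hx => agree_of_eq μ ν π hμ hν hπ heq F₁ F₂ H h₁ h₂ hH hp hm hn x
        (not_not.1 hx)),
    count_restrict μ ν G₁ G₂ k₁ k₂ (fun x => G₁ x ≠ G₂ x) (fun x h => not_not.1 h) r₁ r₂
      (fun H hH hm hn x hx => agree_of_eq μ ν π hμ hν hπ heq G₁ G₂ H k₁ k₂ hH kp hm hn x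
        (not_not.1 hx))]
  obtain ⟨e, e1, e2⟩ := exists_conj (hcard.trans kcard.symm) π _ _ _ _
    (restrict_pm h₁ q₁) (restrict_pm h₂ q₂) (restrict_pm k₁ r₁) (restrict_pm k₂ r₂) hc kc
  exact count_congr μ ν _ _ _ _ e e1 e2
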